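/- If (u, w, v) is an adapted triple of ordered bases for (U, W) with respect to the flag V_•, with associated combinatorial data (ᾱ, β̄, γ̄, σ), then β̄ ∪ γ̄ = {i ∈ {1,…,n} : dim(W ∩ V_i) > dim(W ∩ V_{i−1})}. -/

import Mathlib

/-- The support (set of indices of basis vectors of `V` involved) of an entry describing a
basis vector of `W`: either a single index `β`, or a pair `(γ, δ)`. -/
def suppOf {n : ℕ} : (Fin n) ⊕ (Fin n × Fin n) → Finset (Fin n)
  | Sum.inl b => {b}
  | Sum.inr p => {p.1, p.2}

/-- A complete flag `V_0 = 0 ⊂ V_1 ⊂ ⋯ ⊂ V_n = V` with `dim V_i = i`. -/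
def IsCompleteFlag (K V : Type*) [Field K] [AddCommGroup V] [Module K V]
    (n : ℕ) (flag : ℕ → Submodule K V) : Prop :=
  flag 0 = ⊥ ∧ flag n = ⊤ ∧ (∀ i, i ≤ n → Module.finrank K (flag i) = i) ∧
    ∀ i j, i ≤ j → j ≤ n → flag i ≤ flag j

/-- An *adapted triple* of ordered bases `(u, w, v)` of `(U, W, V)` with respect to the
complete flag `flag`: `v` spans the flag, each `u i` is a flag basis vector `v (α i)`,
each `w i` is either a flag basis vector `v β` or a sum `v γ + v δ` with `δ < γ`,
`γ ∈ range α`, all the indices `β, γ, δ` are pairwise distinct, and no `δ` lies in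
`range α`. -/
structure AdaptedTriple (K V : Type*) [Field K] [AddCommGroup V] [Module K V]
    (n k l : ℕ) (flag : ℕ → Submodule K V) (U W : Submodule K V) where
  v : Fin n → V
  u : Fin k → V
  w : Fin l → V
  α : Fin k → Fin n
  idx : Fin l → (Fin n) ⊕ (Fin n × Fin n)
  hv_indep : LinearIndependent K v
  hu_indep : LinearIndependent K u
  hw_indep : LinearIndependent K w
  hflag : ∀ m : ℕ, m ≤ n → flag m = Submodule.span K (v '' {j : Fin n | (j : ℕ) < m})
  hu_span : Submodule.span K (Set.range u) = U
  hw_span : Submodule.span K (Set.range w) = W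
  hα : Function.Injective α
  hu : ∀ i, u i = v (α i)
  hw_single : ∀ i b, idx i = Sum.inl b → w i = v b
  hw_pair : ∀ i γ δ, idx i = Sum.inr (γ, δ) →
    w i = v γ + v δ ∧ δ < γ ∧ γ ∈ Set.range α
  hsupp : ∀ i j, i ≠ j → Disjoint (suppOf (idx i)) (suppOf (idx j))
  hδ : ∀ i γ δ, idx i = Sum.inr (γ, δ) → δ ∉ Set.range α

namespace AdaptedTriple

variable {K V : Type*} [Field K] [AddCommGroup V] [Module K V]
variable {n k l : ℕ} {flag : ℕ → Submodule K V} {U W : Submodule K V}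

/-- The set `ᾱ` of the combinatorial data of an adapted triple. -/
def alphaSet (T : AdaptedTriple K V n k l flag U W) : Set (Fin n) := Set.range T.α

/-- The set `β̄` of the combinatorial data of an adapted triple. -/
def betaSet (T : AdaptedTriple K V n k l flag U W) : Set (Fin n) :=
  {b | ∃ i, T.idx i = Sum.inl b}

/-- The set `γ̄` of the combinatorial data of an adapted triple. -/
def gammaSet (T : AdaptedTriple K V n k l flag U W) : Set (Fin n) :=
  {g | ∃ i δ, T.idx i = Sum.inr (g, δ)}

/-- The involution `σ`, product of the disjoint transpositions `(γ_i, δ_i)`, of the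
combinatorial data of an adapted triple (as a function `Fin n → Fin n`). -/
noncomputable def sigmaFun (T : AdaptedTriple K V n k l flag U W) : Fin n → Fin n :=
  fun x =>
    if h : ∃ p : Fin n × Fin n, (∃ i, T.idx i = Sum.inr p) ∧ (x = p.1 ∨ x = p.2) then
      (if x = h.choose.1 then h.choose.2 else h.choose.1)
    else x

end AdaptedTriple

/-- The leading index of an entry describing a basis vector of `W`: `β` for a single index,
`γ` for a pair `(γ, δ)`. -/
def leadOf {n : ℕ} : (Fin n) ⊕ (Fin n × Fin n) → Fin n :=
  Sum.elim id Prod.fst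

lemma leadOf_mem_suppOf {n : ℕ} (s : (Fin n) ⊕ (Fin n × Fin n)) : leadOf s ∈ suppOf s := by
  rcases s with b | p <;> simp [leadOf, suppOf]

namespace AdaptedTriple

variable {K V : Type*} [Field K] [AddCommGroup V] [Module K V]
variable {n k l : ℕ} {flag : ℕ → Submodule K V} {U W : Submodule K V}

lemma betaSet_union_gammaSet (T : AdaptedTriple K V n k l flag U W) :
    T.betaSet ∪ T.gammaSet = Set.range fun j => leadOf (T.idx j) := by
  ext i
  constructor
  · rintro (⟨j, hj⟩ | ⟨j, δ, hj⟩) <;> exact ⟨j, by simp [hj, leadOf]⟩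
  · rintro ⟨j, rfl⟩
    rcases hj : T.idx j with b | ⟨γ, δ⟩
    · exact Or.inl ⟨j, by simp [hj, leadOf]⟩
    · exact Or.inr ⟨j, δ, by simp [hj, leadOf]⟩

lemma le_leadOf (T : AdaptedTriple K V n k l flag U W) {j : Fin l} {t : Fin n}
    (ht : t ∈ suppOf (T.idx j)) : t ≤ leadOf (T.idx j) := by
  rcases hj : T.idx j with b | ⟨γ, δ⟩
  · simp_all [suppOf, leadOf]
  · have hlt := (T.hw_pair j γ δ hj).2.1
    rw [hj] at ht
    rcases (by simpa [suppOf] using ht : t = γ ∨ t = δ) with rfl | rfl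
    · exact le_rfl
    · exact hlt.le

lemma mem_flag_iff (T : AdaptedTriple K V n k l flag U W) {b : Module.Basis (Fin n) K V}
    (hb : ⇑b = T.v) {m : ℕ} (hm : m ≤ n) {x : V} :
    x ∈ flag m ↔ ∀ t : Fin n, m ≤ (t : ℕ) → b.repr x t = 0 := by
  rw [T.hflag m hm, ← hb, Module.Basis.mem_span_image]
  refine forall_congr' fun t => ?_
  rw [Finset.mem_coe, Finsupp.mem_support_iff, Set.mem_ofPred_eq, not_imp_comm, not_lt]

lemma repr_w_leadOf (T : AdaptedTriple K V n k l flag U W) {b : Module.Basis (Fin n) K V}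
    (hb : ⇑b = T.v) (j : Fin l) : b.repr (T.w j) (leadOf (T.idx j)) = 1 := by
  rcases hj : T.idx j with β | ⟨γ, δ⟩
  · simp [T.hw_single j β hj, ← hb, leadOf]
  · obtain ⟨hw, hlt, -⟩ := T.hw_pair j γ δ hj
    simp [hw, ← hb, leadOf, hlt.ne]

lemma repr_w_eq_zero (T : AdaptedTriple K V n k l flag U W) {b : Module.Basis (Fin n) K V}
    (hb : ⇑b = T.v) {j : Fin l} {t : Fin n} (ht : t ∉ suppOf (T.idx j)) :
    b.repr (T.w j) t = 0 := by
  rcases hj : T.idx j with β | ⟨γ, δ⟩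
  · have : t ≠ β := by simpa [hj, suppOf] using ht
    simp [T.hw_single j β hj, ← hb, this.symm]
  · obtain ⟨hγ, hδ⟩ : t ≠ γ ∧ t ≠ δ := by simpa [hj, suppOf] using ht
    simp [(T.hw_pair j γ δ hj).1, ← hb, hγ.symm, hδ.symm]

lemma w_mem_flag_iff (T : AdaptedTriple K V n k l flag U W) {b : Module.Basis (Fin n) K V}
    (hb : ⇑b = T.v) {m : ℕ} (hm : m ≤ n) (j : Fin l) :
    T.w j ∈ flag m ↔ (leadOf (T.idx j) : ℕ) < m := by
  rw [T.mem_flag_iff hb hm]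
  constructor
  · intro h
    by_contra! hle
    exact one_ne_zero ((T.repr_w_leadOf hb j).symm.trans (h _ hle))
  · intro h t hmt
    refine T.repr_w_eq_zero hb fun ht => ?_
    have : (t : ℕ) ≤ leadOf (T.idx j) := T.le_leadOf ht
    omega

lemma repr_sum_leadOf (T : AdaptedTriple K V n k l flag U W) {b : Module.Basis (Fin n) K V}
    (hb : ⇑b = T.v) (c : Fin l → K) (j : Fin l) :
    b.repr (∑ i, c i • T.w i) (leadOf (T.idx j)) = c j := by
  rw [map_sum, Finsupp.finsetSum_apply, Finset.sum_eq_single j]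
  · simp [T.repr_w_leadOf hb]
  · intro i _ hij
    have := Finset.disjoint_right.mp (T.hsupp i j hij) (leadOf_mem_suppOf _)
    simp [T.repr_w_eq_zero hb this]
  · simp

/-- `W ∩ V_m` is spanned by those `w j` whose leading index is less than `m`. -/
lemma inf_flag_eq_span (T : AdaptedTriple K V n k l flag U W) {b : Module.Basis (Fin n) K V}
    (hb : ⇑b = T.v) {m : ℕ} (hm : m ≤ n) :
    W ⊓ flag m = Submodule.span K (T.w '' {j | (leadOf (T.idx j) : ℕ) < m}) := by
  apply le_antisymm
  · rintro x ⟨hxW, hxm⟩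
    rw [SetLike.mem_coe, ← T.hw_span, Submodule.mem_span_range_iff_exists_fun] at hxW
    obtain ⟨c, rfl⟩ := hxW
    refine Submodule.sum_mem _ fun j _ => ?_
    by_cases hj : (leadOf (T.idx j) : ℕ) < m
    · exact Submodule.smul_mem _ _ (Submodule.subset_span ⟨j, hj, rfl⟩)
    · have hc : c j = 0 := (T.repr_sum_leadOf hb c j).symm.trans
        ((T.mem_flag_iff hb hm).mp hxm _ (not_lt.mp hj))
      simp [hc]
  · rw [Submodule.span_le]
    rintro _ ⟨j, hj, rfl⟩
    exact ⟨T.hw_span.le (Submodule.subset_span ⟨j, rfl⟩), (T.w_mem_flag_iff hb hm j).mpr hj⟩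

end AdaptedTriple

/-- For an adapted triple for `(U, W)` with respect to the flag `V_•`,
the set `β̄ ∪ γ̄` equals `{i : dim (W ∩ V_i) > dim (W ∩ V_{i-1})}` (here, with `0`-based
indexing, `j ∈ β̄ ∪ γ̄` iff `dim (W ∩ V_{j+1}) > dim (W ∩ V_j)`). -/
theorem betaSet_union_gammaSet_eq_jumps
    (K V : Type*) [Field K] [AddCommGroup V] [Module K V] [FiniteDimensional K V]
    (n k l : ℕ) (hV : Module.finrank K V = n)
    (flag : ℕ → Submodule K V) (hflag : IsCompleteFlag K V n flag)
    (U W : Submodule K V) (hU : Module.finrank K U = k) (hW : Module.finrank K W = l)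
    (T : AdaptedTriple K V n k l flag U W) :
    T.betaSet ∪ T.gammaSet = {i : Fin n |
      Module.finrank K ↥(W ⊓ flag ((i : ℕ) + 1)) > Module.finrank K ↥(W ⊓ flag (i : ℕ))} := by
  obtain ⟨b, hb⟩ : ∃ b : Module.Basis (Fin n) K V, ⇑b = T.v := by
    have hspan : ⊤ ≤ Submodule.span K (Set.range T.v) := by
      rw [T.hv_indep.span_eq_top_of_card_eq_finrank' (by simp [hV])]
    exact ⟨Module.Basis.mk T.hv_indep hspan, Module.Basis.coe_mk _ _⟩
  rw [T.betaSet_union_gammaSet]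
  ext i
  have hle : W ⊓ flag (i : ℕ) ≤ W ⊓ flag ((i : ℕ) + 1) :=
    inf_le_inf_left W (hflag.2.2.2 _ _ (Nat.le_succ _) i.isLt)
  constructor
  · rintro ⟨j, rfl⟩
    refine Submodule.finrank_lt_finrank_of_lt (lt_of_le_of_ne hle fun heq => ?_)
    have hmem : T.w j ∈ W ⊓ flag ((leadOf (T.idx j) : ℕ) + 1) :=
      ⟨T.hw_span.le (Submodule.subset_span ⟨j, rfl⟩),
        (T.w_mem_flag_iff hb (leadOf (T.idx j)).isLt j).mpr (Nat.lt_succ_self _)⟩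
    rw [← heq] at hmem
    exact lt_irrefl _ ((T.w_mem_flag_iff hb (leadOf (T.idx j)).isLt.le j).mp hmem.2)
  · intro hi
    by_contra hlead
    refine (ne_of_gt hi) (congrArg (fun S : Submodule K V => Module.finrank K S) ?_)
    rw [T.inf_flag_eq_span hb i.isLt, T.inf_flag_eq_span hb i.isLt.le]
    congr 2
    ext j
    have hne : (leadOf (T.idx j) : ℕ) ≠ i := fun h => hlead ⟨j, Fin.ext h⟩
    simp only [Set.mem_ofPred_eq]
    omega
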